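/- (Score representation.) Let n ∈ ℕ, and for t = 1,…,n let Û_t = (Û_{1,t}, Û_{2,t}) ∈ (0,1)² and Z_t ∈ ℝᵏ be given; set X_t := (1, Z_tᵀ)ᵀ ∈ ℝ^{k+1}. Fix u = (u₁,u₂) ∈ (0,1)² and define z_i := Φ⁻¹(u_i). For θ = (α, β) ∈ ℝ × ℝᵏ define ϱ_t(θ) := tanh(α + βᵀZ_t), C_t(θ) := Φ₂(z₁,z₂;ϱ_t(θ)), the quadrant indicators d̂_{1,t}(u) := 𝟙{Û_{1,t} ≤ u₁, Û_{2,t} ≤ u₂}, d̂_{2,t}(u) := 𝟙{Û_{1,t} ≤ u₁, Û_{2,t} > u₂}, d̂_{3,t}(u) := 𝟙{Û_{1,t} > u₁, Û_{2,t} ≤ u₂}, d̂_{4,t}(u) := 𝟙{Û_{1,t} > u₁, Û_{2,t} > u₂}, and the log-likelihood ℓ̂(u,s,θ) := n⁻¹ Σ_{t=1}^{⌊sn⌋} [ d̂_{1,t} log C_t(θ) + d̂_{2,t} log(u₁ − C_t(θ)) + d̂_{3,t} log(u₂ − C_t(θ)) + d̂_{4,t} log(1 − u₁ − u₂ + C_t(θ))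 ]. Fix α₀ ∈ ℝ, let θ₀ := (α₀, 0), write p₁ := Φ₂(z₁,z₂;tanh α₀), p₂ := u₁ − p₁... p₄ := 1 − u₁ − u₂ + p₁ (all strictly positive), τ := (1 − tanh²α₀)·φ₂(z₁,z₂;tanh α₀), and e := (1,−1,−1,1). Then for every s ∈ [0,1], the gradient of ℓ̂ in θ at θ₀ exists and satisfies ∇_θ ℓ̂(u,s,θ₀) = τ · n⁻¹ Σ_{t=1}^{⌊sn⌋} X_t Σ_{j=1}^{4} eⱼ d̂_{j,t}(u)/pⱼ. -/

import Mathlib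

open MeasureTheory Real Set Filter

/-- Standard univariate normal cdf Φ. -/
noncomputable def stdNormalCDF (z : ℝ) : ℝ :=
  ∫ x in Set.Iic z, (Real.sqrt (2 * Real.pi))⁻¹ * Real.exp (-(x ^ 2) / 2)

/-- Φ⁻¹, the (left-)inverse of the standard normal cdf. -/
noncomputable def stdNormalInv : ℝ → ℝ := Function.invFun stdNormalCDF

/-- Standard bivariate normal density φ₂(x,y;ρ), ρ ∈ (−1,1). -/
noncomputable def phi2 (ρ x y : ℝ) : ℝ :=
  (2 * Real.pi * Real.sqrt (1 - ρ ^ 2))⁻¹ *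
    Real.exp (-(x ^ 2 - 2 * ρ * x * y + y ^ 2) / (2 * (1 - ρ ^ 2)))

/-- Standard bivariate normal cdf Φ₂(z₁,z₂;ρ) = ∫_{−∞}^{z₁} ∫_{−∞}^{z₂} φ₂(x,y;ρ) dy dx. -/
noncomputable def Phi2 (ρ z₁ z₂ : ℝ) : ℝ :=
  ∫ x in Set.Iic z₁, ∫ y in Set.Iic z₂, phi2 ρ x y


noncomputable def gden (x : ℝ) : ℝ := (Real.sqrt (2 * Real.pi))⁻¹ * Real.exp (-(x ^ 2) / 2)

lemma gden_pos (x : ℝ) : 0 < gden x := by unfold gden; positivity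

lemma gden_le (x : ℝ) : gden x ≤ 1 := by
  unfold gden
  have h1 : (1:ℝ) ≤ Real.sqrt (2 * Real.pi) := by
    rw [Real.one_le_sqrt]; nlinarith [Real.pi_gt_three]
  have h2 : Real.exp (-(x ^ 2) / 2) ≤ 1 := Real.exp_le_one_iff.2 (by nlinarith [sq_nonneg x])
  calc _ ≤ (1:ℝ) * 1 := by
        apply mul_le_mul (inv_le_one_of_one_le₀ h1) h2 (by positivity) (by norm_num)
    _ = 1 := by norm_num

lemma gden_cont : Continuous gden := by unfold gden; fun_prop

lemma gden_eq : gden = ProbabilityTheory.gaussianPDFReal 0 1 := by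
  ext x; simp [gden, ProbabilityTheory.gaussianPDFReal]

lemma gden_int : Integrable gden := by
  rw [gden_eq]; exact ProbabilityTheory.integrable_gaussianPDFReal 0 1

lemma gden_total : ∫ x, gden x = 1 := by
  rw [gden_eq]; exact ProbabilityTheory.integral_gaussianPDFReal_eq_one 0 one_ne_zero

lemma cdf_eq (z : ℝ) : stdNormalCDF z = ∫ x in Set.Iic z, gden x := rfl

lemma cdf_deriv (z : ℝ) : HasDerivAt stdNormalCDF (gden z) z := by
  have h : stdNormalCDF = fun z => stdNormalCDF 0 + ∫ x in (0:ℝ)..z, gden x := by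
    ext w
    rw [← intervalIntegral.integral_Iic_sub_Iic gden_int.integrableOn gden_int.integrableOn,
      cdf_eq, cdf_eq]; ring
  rw [h]
  exact (intervalIntegral.integral_hasDerivAt_right (gden_cont.intervalIntegrable _ _)
    (gden_cont.stronglyMeasurableAtFilter _ _) gden_cont.continuousAt).const_add _

lemma cdf_cont : Continuous stdNormalCDF :=
  continuous_iff_continuousAt.2 fun z => (cdf_deriv z).continuousAt

lemma cdf_bot : Tendsto stdNormalCDF atBot (nhds 0) :=
  MeasureTheory.tendsto_integral_Iic_zero tendsto_id

lemma cdf_top : Tendsto stdNormalCDF atTop (nhds 1) := by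
  rw [← gden_total]
  exact (aecover_Iic tendsto_id).integral_tendsto_of_countably_generated gden_int

lemma setInt_pos {f : ℝ → ℝ} {s : Set ℝ} (hs : MeasurableSet s) (hv : volume s ≠ 0)
    (hf : ∀ x, 0 < f x) (hi : Integrable f) : 0 < ∫ x in s, f x := by
  rw [integral_pos_iff_support_of_nonneg (fun x => (hf x).le) hi.integrableOn]
  have : Function.support f = Set.univ := by ext x; simp [(hf x).ne']
  rw [this]; simpa [pos_iff_ne_zero] using hv

lemma cdf_pos (z : ℝ) : 0 < stdNormalCDF z :=
  setInt_pos measurableSet_Iic (by simp) gden_pos gden_int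

lemma cdf_compl (z : ℝ) : (∫ x in Set.Ioi z, gden x) = 1 - stdNormalCDF z := by
  have := intervalIntegral.integral_Iic_add_Ioi (b := z) gden_int.integrableOn gden_int.integrableOn
  rw [gden_total] at this
  rw [cdf_eq]; linarith

lemma cdf_lt (z : ℝ) : stdNormalCDF z < 1 := by
  have : 0 < ∫ x in Set.Ioi z, gden x :=
    setInt_pos measurableSet_Ioi (by simp) gden_pos gden_int
  rw [cdf_compl] at this; linarith

lemma cdf_inv {u : ℝ} (hu : u ∈ Set.Ioo (0:ℝ) 1) : stdNormalCDF (stdNormalInv u) = u := by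
  apply Function.invFun_eq
  have h1 := (cdf_bot.eventually (gt_mem_nhds hu.1)).exists
  have h2 := (cdf_top.eventually (lt_mem_nhds hu.2)).exists
  obtain ⟨a, ha⟩ := h1
  obtain ⟨b, hb⟩ := h2
  exact mem_range_of_exists_le_of_exists_ge cdf_cont ⟨a, ha.le⟩ ⟨b, hb.le⟩

noncomputable def sg (ρ : ℝ) : ℝ := Real.sqrt (1 - ρ ^ 2)

lemma sg_pos {ρ : ℝ} (h : ρ ^ 2 < 1) : 0 < sg ρ := Real.sqrt_pos.2 (by linarith)
lemma sg_sq {ρ : ℝ} (h : ρ ^ 2 < 1) : sg ρ ^ 2 = 1 - ρ ^ 2 := Real.sq_sqrt (by linarith)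

lemma phi2_eq {ρ : ℝ} (h : ρ ^ 2 < 1) (x y : ℝ) :
    phi2 ρ x y = gden x * (gden ((y - ρ * x) / sg ρ) * (sg ρ)⁻¹) := by
  have h0 := sg_pos h
  have h1 := sg_sq h
  have hpi : Real.sqrt (2 * Real.pi) ^ 2 = 2 * Real.pi := Real.sq_sqrt (by positivity)
  have hne : 1 - ρ ^ 2 ≠ 0 := by linarith
  have e1 : -(x ^ 2 - 2 * ρ * x * y + y ^ 2) / (2 * (1 - ρ ^ 2))
      = -(x ^ 2) / 2 + -(((y - ρ * x) / sg ρ) ^ 2) / 2 := by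
    rw [div_pow, h1]; field_simp; ring
  unfold phi2 gden
  rw [e1, Real.exp_add]
  change (2 * Real.pi * sg ρ)⁻¹ * _ = _
  have hpi2 : (2 * Real.pi * sg ρ)⁻¹ = (Real.sqrt (2 * Real.pi) ^ 2 * sg ρ)⁻¹ := by rw [hpi]
  rw [hpi2]
  rw [mul_inv, sq, mul_inv]; ring

lemma phi2_symm (ρ x y : ℝ) : phi2 ρ x y = phi2 ρ y x := by
  unfold phi2; ring_nf

lemma phi2_pos {ρ : ℝ} (h : ρ ^ 2 < 1) (x y : ℝ) : 0 < phi2 ρ x y := by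
  rw [phi2_eq h]
  have := gden_pos x
  have := gden_pos ((y - ρ * x) / sg ρ)
  have := sg_pos h
  positivity

lemma phi2_int {ρ : ℝ} (h : ρ ^ 2 < 1) (x : ℝ) : Integrable (fun y => phi2 ρ x y) := by
  simp_rw [phi2_eq h]
  exact (((gden_int.comp_div (sg_pos h).ne').comp_sub_right (ρ * x)).mul_const _).const_mul _

lemma phi2_total {ρ : ℝ} (h : ρ ^ 2 < 1) (x : ℝ) : ∫ y, phi2 ρ x y = gden x := by
  simp_rw [phi2_eq h]
  rw [integral_const_mul, integral_mul_const,
    integral_sub_right_eq_self (fun y => gden (y / sg ρ)) (ρ * x),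
    MeasureTheory.Measure.integral_comp_div gden, gden_total, abs_of_pos (sg_pos h)]
  have := (sg_pos h).ne'
  simp [this]

/-- conditional cdf factor -/
noncomputable def cc (ρ z x : ℝ) : ℝ := stdNormalCDF ((z - ρ * x) / sg ρ)

lemma phi2_inner {ρ : ℝ} (h : ρ ^ 2 < 1) (x z : ℝ) :
    ∫ y in Set.Iic z, phi2 ρ x y = gden x * cc ρ z x := by
  have hs := sg_pos h
  have := integral_Iic_of_hasDerivAt_of_tendsto' (a := z) (m := 0)
    (f := fun y => gden x * stdNormalCDF ((y - ρ * x) / sg ρ)) (f' := fun y => phi2 ρ x y)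
    (fun y _ => by
      rw [phi2_eq h]
      have hl : HasDerivAt (fun y => (y - ρ * x) / sg ρ) ((sg ρ)⁻¹) y := by
        simpa using ((hasDerivAt_id y).sub_const (ρ * x)).div_const (sg ρ)
      exact ((cdf_deriv _).comp y hl).const_mul _)
    (phi2_int h x).integrableOn
    (by
      have hl : Tendsto (fun y => (y - ρ * x) / sg ρ) atBot atBot :=
        (tendsto_atBot_add_const_right _ (-(ρ * x)) tendsto_id).atBot_div_const hs
      simpa using (cdf_bot.comp hl).const_mul (gden x))
  rw [this, sub_zero]; rfl

lemma Phi2_eq {ρ : ℝ} (h : ρ ^ 2 < 1) (z₁ z₂ : ℝ) :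
    Phi2 ρ z₁ z₂ = ∫ x in Set.Iic z₁, gden x * cc ρ z₂ x := by
  unfold Phi2
  simp_rw [phi2_inner h]

lemma cc_cont (ρ z : ℝ) : Continuous (cc ρ z) := by
  unfold cc; exact cdf_cont.comp (by fun_prop)

lemma gcc_int (ρ z : ℝ) : Integrable (fun x => gden x * cc ρ z x) := by
  refine gden_int.mono' ((gden_cont.mul (cc_cont ρ z)).aestronglyMeasurable) ?_
  refine Eventually.of_forall fun x => ?_
  have h1 := cdf_pos ((z - ρ * x) / sg ρ)
  have h2 := cdf_lt ((z - ρ * x) / sg ρ)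
  have := gden_pos x
  unfold cc
  rw [Real.norm_eq_abs, abs_of_pos (by positivity)]
  nlinarith

lemma phi2_cont (ρ : ℝ) : Continuous (fun q : ℝ × ℝ => phi2 ρ q.1 q.2) := by
  unfold phi2; fun_prop

lemma phi2_prod_int {ρ : ℝ} (h : ρ ^ 2 < 1) :
    Integrable (fun q : ℝ × ℝ => phi2 ρ q.1 q.2) := by
  rw [Measure.volume_eq_prod, integrable_prod_iff (phi2_cont ρ).aestronglyMeasurable]
  refine ⟨Eventually.of_forall fun x => phi2_int h x, ?_⟩
  simp_rw [Real.norm_eq_abs, abs_of_pos (phi2_pos h _ _), phi2_total h]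
  exact gden_int

lemma gcc_total {ρ : ℝ} (h : ρ ^ 2 < 1) (z : ℝ) :
    ∫ x, gden x * cc ρ z x = stdNormalCDF z := by
  simp_rw [← phi2_inner h]
  rw [integral_integral_swap]
  · rw [cdf_eq]
    simp_rw [fun y => (integral_congr_ae (Eventually.of_forall fun x => phi2_symm ρ x y) :
      ∫ x, phi2 ρ x y = ∫ x, phi2 ρ y x), phi2_total h]
  · refine (phi2_prod_int h).mono_measure ?_
    rw [Measure.volume_eq_prod]
    exact Measure.prod_mono le_rfl Measure.restrict_le_self

lemma p0_pos {ρ : ℝ} (h : ρ ^ 2 < 1) (z₁ z₂ : ℝ) : 0 < Phi2 ρ z₁ z₂ := by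
  rw [Phi2_eq h]
  exact setInt_pos measurableSet_Iic (by simp) (fun x => mul_pos (gden_pos x) (cdf_pos _))
    (gcc_int _ _)

lemma gcc'_pos {s : Set ℝ} (hs : MeasurableSet s) (hv : volume s ≠ 0) (ρ z : ℝ) :
    ∫ x in s, gden x * cc ρ z x < ∫ x in s, gden x := by
  rw [← sub_pos, ← integral_sub gden_int.integrableOn (gcc_int _ _).integrableOn]
  refine setInt_pos hs hv (fun x => ?_) (gden_int.sub (gcc_int _ _))
  have := cdf_lt ((z - ρ * x) / sg ρ)
  have := gden_pos x
  unfold cc; nlinarith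

lemma p1_pos {ρ : ℝ} (h : ρ ^ 2 < 1) (z₁ z₂ : ℝ) : 0 < stdNormalCDF z₁ - Phi2 ρ z₁ z₂ := by
  rw [Phi2_eq h, cdf_eq, sub_pos]
  exact gcc'_pos measurableSet_Iic (by simp) _ _

lemma p2_eq {ρ : ℝ} (h : ρ ^ 2 < 1) (z₁ z₂ : ℝ) :
    stdNormalCDF z₂ - Phi2 ρ z₁ z₂ = ∫ x in Set.Ioi z₁, gden x * cc ρ z₂ x := by
  have := intervalIntegral.integral_Iic_add_Ioi (b := z₁) (gcc_int ρ z₂).integrableOn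
    (gcc_int ρ z₂).integrableOn
  rw [gcc_total h] at this
  rw [Phi2_eq h]; linarith

lemma p2_pos {ρ : ℝ} (h : ρ ^ 2 < 1) (z₁ z₂ : ℝ) : 0 < stdNormalCDF z₂ - Phi2 ρ z₁ z₂ := by
  rw [p2_eq h]
  exact setInt_pos measurableSet_Ioi (by simp) (fun x => mul_pos (gden_pos x) (cdf_pos _))
    (gcc_int _ _)

lemma p3_pos {ρ : ℝ} (h : ρ ^ 2 < 1) (z₁ z₂ : ℝ) :
    0 < 1 - stdNormalCDF z₁ - stdNormalCDF z₂ + Phi2 ρ z₁ z₂ := by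
  have h1 := gcc'_pos (s := Set.Ioi z₁) measurableSet_Ioi (by simp) ρ z₂
  rw [← p2_eq h, cdf_compl] at h1
  linarith

lemma sg_deriv {ρ : ℝ} (h : ρ ^ 2 < 1) : HasDerivAt sg (-ρ / sg ρ) ρ := by
  have h1 : HasDerivAt (fun r : ℝ => 1 - r ^ 2) (-(2 * ρ)) ρ := by
    simpa using (hasDerivAt_pow 2 ρ).const_sub 1
  have := h1.sqrt (by linarith)
  refine this.congr_deriv ?_
  change _ / (2 * sg ρ) = _
  have := (sg_pos h).ne'
  field_simp

/-- ρ-derivative of the integrand, which is also the x-derivative of phi2 -/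
noncomputable def dphi (ρ x z : ℝ) : ℝ := phi2 ρ x z * ((ρ * z - x) / (1 - ρ ^ 2))

lemma gcc_deriv {ρ : ℝ} (h : ρ ^ 2 < 1) (x z : ℝ) :
    HasDerivAt (fun r => gden x * cc r z x) (dphi ρ x z) ρ := by
  have hs := (sg_pos h).ne'
  have hq := sg_sq h
  have h1 : HasDerivAt (fun r : ℝ => z - r * x) (-x) ρ := by
    simpa using ((hasDerivAt_id ρ).mul_const x).const_sub z
  have h2 := h1.div (sg_deriv h) hs
  have h3 := ((cdf_deriv ((z - ρ * x) / sg ρ)).comp ρ h2).const_mul (gden x)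
  refine h3.congr_deriv ?_
  unfold dphi
  rw [phi2_eq h, ← hq]
  have : ρ ^ 2 = 1 - sg ρ ^ 2 := by linarith
  have e2 : (-x * sg ρ - (z - ρ * x) * (-ρ / sg ρ)) / sg ρ ^ 2
      = (sg ρ)⁻¹ * ((ρ * z - x) / sg ρ ^ 2) := by
    field_simp
    linear_combination (-x) * this
  rw [e2]; ring

lemma dphi_eq_x (ρ x z : ℝ) (h : ρ ^ 2 < 1) : HasDerivAt (fun w => phi2 ρ w z) (dphi ρ x z) x := by
  have hne : 1 - ρ ^ 2 ≠ 0 := by linarith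
  have h1 : HasDerivAt (fun w : ℝ => -(w ^ 2 - 2 * ρ * w * z + z ^ 2) / (2 * (1 - ρ ^ 2)))
      (-(2 * x - 2 * ρ * z) / (2 * (1 - ρ ^ 2))) x := by
    have a := hasDerivAt_pow 2 x
    have b := ((hasDerivAt_id x).const_mul (2 * ρ)).mul_const z
    have := (((a.sub b).add_const (z ^ 2)).neg).div_const (2 * (1 - ρ ^ 2))
    simpa using this
  have := h1.exp.const_mul ((2 * Real.pi * Real.sqrt (1 - ρ ^ 2))⁻¹)
  refine this.congr_deriv ?_
  unfold dphi phi2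
  rw [mul_assoc]
  have e3 : -(2 * x - 2 * ρ * z) / (2 * (1 - ρ ^ 2)) = (ρ * z - x) / (1 - ρ ^ 2) := by
    field_simp
    ring
  rw [e3]; ring

lemma gden_tendsto : Tendsto gden atBot (nhds 0) := by
  have h := (tendsto_pow_atTop (α := ℝ) (n := 2) two_ne_zero).comp tendsto_neg_atBot_atTop
  have h2 : Tendsto (fun x : ℝ => -(x ^ 2) / 2) atBot atBot := by
    have := (tendsto_neg_atTop_atBot.comp h).atBot_div_const (r := (2:ℝ)) (by norm_num)
    refine this.congr fun x => ?_
    simp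
  have := (Real.tendsto_exp_atBot.comp h2).const_mul ((Real.sqrt (2 * Real.pi))⁻¹)
  rw [mul_zero] at this
  exact this

lemma phi2_le {ρ : ℝ} (h : ρ ^ 2 < 1) (x z : ℝ) : phi2 ρ x z ≤ gden x * (sg ρ)⁻¹ := by
  rw [phi2_eq h]
  have h1 := gden_pos x
  have h2 := gden_le ((z - ρ * x) / sg ρ)
  have h3 := inv_pos.2 (sg_pos h)
  exact mul_le_mul_of_nonneg_left (by nlinarith) h1.le

lemma phi2_tendsto {ρ : ℝ} (h : ρ ^ 2 < 1) (z : ℝ) :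
    Tendsto (fun x => phi2 ρ x z) atBot (nhds 0) :=
  squeeze_zero (fun x => (phi2_pos h x z).le) (fun x => phi2_le h x z)
    (by simpa using gden_tendsto.mul_const (sg ρ)⁻¹)

lemma gabs_int : Integrable (fun x => gden x * |x|) := by
  have h := (integrable_mul_exp_neg_mul_sq (b := 1/2) (by norm_num)).abs.const_mul
    ((Real.sqrt (2 * Real.pi))⁻¹)
  refine h.congr (Eventually.of_forall fun x => ?_)
  simp only [gden, abs_mul, abs_of_pos (Real.exp_pos _)]
  rw [show -(1/2:ℝ) * x ^ 2 = -(x^2)/2 by ring]; ring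

lemma dphi_bound {ρ c : ℝ} (hc : 0 < c) (hc1 : c ≤ 1) (h : ρ ^ 2 ≤ 1 - c ^ 2) (x z : ℝ) :
    ‖dphi ρ x z‖ ≤ (gden x * |x| + gden x * |z|) * (c⁻¹ * (c ^ 2)⁻¹) := by
  have hc2 : 0 < c ^ 2 := by positivity
  have h1 : ρ ^ 2 < 1 := by linarith
  have hg := gden_pos x
  have hsg : c ≤ sg ρ := Real.le_sqrt_of_sq_le (by linarith)
  have hA : phi2 ρ x z ≤ gden x * c⁻¹ :=
    (phi2_le h1 x z).trans (mul_le_mul_of_nonneg_left (inv_anti₀ hc hsg) hg.le)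
  have hρ : |ρ| ≤ 1 := by
    rw [← sq_le_one_iff_abs_le_one]; exact h1.le
  have hB : |ρ * z - x| ≤ |x| + |z| := by
    calc _ ≤ |ρ * z| + |x| := abs_sub _ _
      _ ≤ _ := by rw [abs_mul]; nlinarith [abs_nonneg z]
  have hC : (1 - ρ ^ 2)⁻¹ ≤ (c ^ 2)⁻¹ := inv_anti₀ hc2 (by linarith)
  have hD : 0 < 1 - ρ ^ 2 := by linarith
  unfold dphi
  rw [Real.norm_eq_abs, abs_mul, abs_div, abs_of_pos (phi2_pos h1 x z), abs_of_pos hD, div_eq_mul_inv]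
  calc _ ≤ (gden x * c⁻¹) * ((|x| + |z|) * (c ^ 2)⁻¹) := by gcongr
    _ = _ := by ring

lemma plackett {ρ : ℝ} (h : ρ ^ 2 < 1) (z₁ z₂ : ℝ) :
    HasDerivAt (fun r => Phi2 r z₁ z₂) (phi2 ρ z₁ z₂) ρ := by
  obtain ⟨c, hc, hc1, hcρ⟩ : ∃ c : ℝ, 0 < c ∧ c ≤ 1 ∧ ρ ^ 2 < 1 - c ^ 2 := by
    refine ⟨sg ρ / 2, half_pos (sg_pos h), ?_, ?_⟩
    · have := sg_sq h
      nlinarith [sq_nonneg ρ, sg_pos h]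
    · have := sg_sq h
      nlinarith
  have hopen : {r : ℝ | r ^ 2 < 1 - c ^ 2} ∈ nhds ρ :=
    (isOpen_lt (by fun_prop) continuous_const).mem_nhds hcρ
  have hlt : ∀ r ∈ {r : ℝ | r ^ 2 < 1 - c ^ 2}, r ^ 2 < 1 := fun r hr => by
    have : r ^ 2 < 1 - c ^ 2 := hr
    nlinarith
  have key := hasDerivAt_integral_of_dominated_loc_of_deriv_le
    (μ := volume.restrict (Set.Iic z₁)) (F := fun r x => gden x * cc r z₂ x)
    (F' := fun r x => dphi r x z₂)
    (bound := fun x => (gden x * |x| + gden x * |z₂|) * (c⁻¹ * (c ^ 2)⁻¹))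
    hopen
    (Eventually.of_forall fun r => (gcc_int r z₂).integrableOn.aestronglyMeasurable)
    (gcc_int ρ z₂).integrableOn
    (by
      have : Continuous (fun x => dphi ρ x z₂) := by unfold dphi phi2; fun_prop
      exact this.aestronglyMeasurable)
    (Eventually.of_forall fun x r hr => dphi_bound hc hc1 (le_of_lt hr) x z₂)
    (((gabs_int.add (gden_int.mul_const _)).mul_const _).integrableOn)
    (Eventually.of_forall fun x r hr => gcc_deriv (hlt r hr) x z₂)
  have hI := integral_Iic_of_hasDerivAt_of_tendsto' (a := z₁)
    (fun x _ => dphi_eq_x ρ x z₂ h) key.1 (phi2_tendsto h z₂)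
  have h2 := key.2
  rw [hI, sub_zero] at h2
  refine h2.congr_of_eventuallyEq ?_
  filter_upwards [hopen] with r hr
  exact Phi2_eq (hlt r hr) z₁ z₂

lemma tanh_deriv (x : ℝ) : HasDerivAt Real.tanh (1 - Real.tanh x ^ 2) x := by
  have h := (Real.hasDerivAt_sinh x).div (Real.hasDerivAt_cosh x) (Real.cosh_pos x).ne'
  have e : Real.tanh = Real.sinh / Real.cosh := by
    ext y; exact Real.tanh_eq_sinh_div_cosh y
  rw [e]
  refine h.congr_deriv ?_
  have := (Real.cosh_pos x).ne'
  simp only [Pi.div_apply]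
  field_simp

/-- score representation: the gradient in θ = (α,β) of the sequential
distribution-regression log-likelihood, evaluated at the restricted point θ₀ = (α₀,0),
exists and equals τ · n⁻¹ Σ_{t≤⌊sn⌋} X_t Σⱼ eⱼ d̂_{j,t}(u)/pⱼ, where X_t = (1, Z_tᵀ)ᵀ.
The gradient is expressed as a continuous linear map L on ℝ × ℝᵏ acting as
v ↦ τ · n⁻¹ Σ_t (v₁ + Z_tᵀ v₂) Σⱼ eⱼ d̂_{j,t}(u)/pⱼ. -/
theorem score_representation
    (k n : ℕ) (Uhat : ℕ → ℝ × ℝ) (Z : ℕ → Fin k → ℝ)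
    (u₁ u₂ : ℝ) (hu₁ : u₁ ∈ Set.Ioo (0 : ℝ) 1) (hu₂ : u₂ ∈ Set.Ioo (0 : ℝ) 1)
    (hUhat : ∀ t, (Uhat t).1 ∈ Set.Ioo (0 : ℝ) 1 ∧ (Uhat t).2 ∈ Set.Ioo (0 : ℝ) 1)
    (z₁ z₂ : ℝ) (hz₁ : z₁ = stdNormalInv u₁) (hz₂ : z₂ = stdNormalInv u₂)
    (s : ℝ) (hs : s ∈ Set.Icc (0 : ℝ) 1)
    (α₀ : ℝ)
    (d : Fin 4 → ℕ → ℝ)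
    (hd0 : ∀ t, d 0 t = if (Uhat t).1 ≤ u₁ ∧ (Uhat t).2 ≤ u₂ then 1 else 0)
    (hd1 : ∀ t, d 1 t = if (Uhat t).1 ≤ u₁ ∧ u₂ < (Uhat t).2 then 1 else 0)
    (hd2 : ∀ t, d 2 t = if u₁ < (Uhat t).1 ∧ (Uhat t).2 ≤ u₂ then 1 else 0)
    (hd3 : ∀ t, d 3 t = if u₁ < (Uhat t).1 ∧ u₂ < (Uhat t).2 then 1 else 0)
    (Ct : (ℝ × (Fin k → ℝ)) → ℕ → ℝ)
    (hCt : ∀ θ t, Ct θ t = Phi2 (Real.tanh (θ.1 + ∑ i, θ.2 i * Z t i)) z₁ z₂)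
    (ℓ : (ℝ × (Fin k → ℝ)) → ℝ)
    (hℓ : ∀ θ, ℓ θ = (n : ℝ)⁻¹ * ∑ t ∈ Finset.Icc 1 ⌊s * (n : ℝ)⌋₊,
      (d 0 t * Real.log (Ct θ t) + d 1 t * Real.log (u₁ - Ct θ t) +
        d 2 t * Real.log (u₂ - Ct θ t) + d 3 t * Real.log (1 - u₁ - u₂ + Ct θ t)))
    (p : Fin 4 → ℝ)
    (hp0 : p 0 = Phi2 (Real.tanh α₀) z₁ z₂)
    (hp1 : p 1 = u₁ - Phi2 (Real.tanh α₀) z₁ z₂)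
    (hp2 : p 2 = u₂ - Phi2 (Real.tanh α₀) z₁ z₂)
    (hp3 : p 3 = 1 - u₁ - u₂ + Phi2 (Real.tanh α₀) z₁ z₂)
    (τ : ℝ) (hτ : τ = (1 - Real.tanh α₀ ^ 2) * phi2 (Real.tanh α₀) z₁ z₂)
    (e : Fin 4 → ℝ) (he : e = ![1, -1, -1, 1]) :
    ∃ L : (ℝ × (Fin k → ℝ)) →L[ℝ] ℝ,
      HasFDerivAt ℓ L (α₀, 0) ∧
      ∀ v : ℝ × (Fin k → ℝ),
        L v = τ * ((n : ℝ)⁻¹ * ∑ t ∈ Finset.Icc 1 ⌊s * (n : ℝ)⌋₊,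
          (v.1 + ∑ i, Z t i * v.2 i) * ∑ j : Fin 4, e j * d j t / p j) := by
  have hr : Real.tanh α₀ ^ 2 < 1 := Real.tanh_sq_lt_one α₀
  have hc1 : stdNormalCDF z₁ = u₁ := by rw [hz₁, cdf_inv hu₁]
  have hc2 : stdNormalCDF z₂ = u₂ := by rw [hz₂, cdf_inv hu₂]
  have q0 : p 0 ≠ 0 := by rw [hp0]; exact (p0_pos hr _ _).ne'
  have q1 : p 1 ≠ 0 := by rw [hp1, ← hc1]; exact (p1_pos hr _ _).ne'
  have q2 : p 2 ≠ 0 := by rw [hp2, ← hc2]; exact (p2_pos hr _ _).ne'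
  have q3 : p 3 ≠ 0 := by rw [hp3, ← hc1, ← hc2]; exact (p3_pos hr _ _).ne'
  -- scalar derivative
  have hA : HasDerivAt (fun a => Phi2 (Real.tanh a) z₁ z₂) τ α₀ := by
    have := (plackett hr z₁ z₂).comp α₀ (tanh_deriv α₀)
    rw [hτ, mul_comm]; exact this
  have hS : ∀ t, HasDerivAt (fun a => d 0 t * Real.log (Phi2 (Real.tanh a) z₁ z₂)
      + d 1 t * Real.log (u₁ - Phi2 (Real.tanh a) z₁ z₂)
      + d 2 t * Real.log (u₂ - Phi2 (Real.tanh a) z₁ z₂)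
      + d 3 t * Real.log (1 - u₁ - u₂ + Phi2 (Real.tanh a) z₁ z₂))
      (τ * ∑ j : Fin 4, e j * d j t / p j) α₀ := by
    intro t
    have a0 := (hA.log (hp0 ▸ q0)).const_mul (d 0 t)
    have a1 := ((hA.const_sub u₁).log (hp1 ▸ q1)).const_mul (d 1 t)
    have a2 := ((hA.const_sub u₂).log (hp2 ▸ q2)).const_mul (d 2 t)
    have a3 := ((hA.const_add (1 - u₁ - u₂)).log (hp3 ▸ q3)).const_mul (d 3 t)
    refine (((a0.add a1).add a2).add a3).congr_deriv ?_
    rw [← hp1, ← hp2, ← hp3, ← hp0, he, Fin.sum_univ_four]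
    simp
    ring
  let M : ℕ → (ℝ × (Fin k → ℝ)) →L[ℝ] ℝ := fun t =>
    ContinuousLinearMap.fst ℝ ℝ (Fin k → ℝ) + ∑ i, Z t i •
      ((ContinuousLinearMap.proj (R := ℝ) (φ := fun _ : Fin k => ℝ) i).comp
        (ContinuousLinearMap.snd ℝ ℝ (Fin k → ℝ)))
  have hM : ∀ t v, M t v = v.1 + ∑ i, Z t i * v.2 i := by
    intro t v; simp [M, ContinuousLinearMap.sum_apply]
  have hM0 : ∀ t, M t (α₀, 0) = α₀ := by intro t; simp [hM]
  refine ⟨(n : ℝ)⁻¹ • ∑ t ∈ Finset.Icc 1 ⌊s * (n : ℝ)⌋₊,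
    (τ * ∑ j : Fin 4, e j * d j t / p j) • M t, ?_, ?_⟩
  · have hℓ' : ℓ = fun θ => (n : ℝ)⁻¹ * ∑ t ∈ Finset.Icc 1 ⌊s * (n : ℝ)⌋₊,
        (d 0 t * Real.log (Phi2 (Real.tanh (M t θ)) z₁ z₂)
      + d 1 t * Real.log (u₁ - Phi2 (Real.tanh (M t θ)) z₁ z₂)
      + d 2 t * Real.log (u₂ - Phi2 (Real.tanh (M t θ)) z₁ z₂)
      + d 3 t * Real.log (1 - u₁ - u₂ + Phi2 (Real.tanh (M t θ)) z₁ z₂)) := by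
      ext θ
      rw [hℓ]
      simp only [hCt, hM, mul_comm]
    rw [hℓ']
    refine HasFDerivAt.const_mul (HasFDerivAt.fun_sum fun t _ => ?_) _
    have h1 := hS t
    rw [← hM0 t] at h1
    exact h1.comp_hasFDerivAt (α₀, (0 : Fin k → ℝ)) (M t).hasFDerivAt
  · intro v
    simp only [ContinuousLinearMap.smul_apply, ContinuousLinearMap.sum_apply, hM, smul_eq_mul,
      Finset.mul_sum (s := Finset.Icc 1 ⌊s * (n : ℝ)⌋₊)]
    refine Finset.sum_congr rfl fun t _ => ?_
    ring
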